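/- arXiv:1111.6082 — 2 statements merged into one kernel-verified Lean document; each statement's English description precedes it below -/
import Mathlib

section
/- Suppose in addition that δ ≥ (m+1)G² + 2mδ²η², and let x_* be a minimizer of ∑_{t=1}^T f_t over K. Then the solutions x_t produced by Algorithm 1 satisfy ∑_{t=1}^T (f_t(x_t) − f_t(x_*)) + ∑_{i=1}^m [∑_{t=1}^T g_i(x_t)]_+² / (2(δηT + m/η)) ≤ R²/(2η) + (ηT/2)((m+1)G² + 2mD²). -/
open RealInnerProductSpace Finset

/-- `p` is the Euclidean (metric) projection of `y` onto the set `C`. -/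
def IsProjOn {E : Type*} [NormedAddCommGroup E] (C : Set E) (y p : E) : Prop :=
  p ∈ C ∧ ∀ z ∈ C, ‖p - y‖ ≤ ‖z - y‖

/-- Projecting onto a convex set does not increase the distance to points of the set. -/
theorem IsProjOn.norm_sub_sq_le {E : Type*} [NormedAddCommGroup E] [InnerProductSpace ℝ E]
    {C : Set E} (hC : Convex ℝ C) {y p z : E} (hp : IsProjOn C y p) (hz : z ∈ C) :
    ‖p - z‖ ^ 2 ≤ ‖y - z‖ ^ 2 := by
  have hinf : ‖y - p‖ = ⨅ w : C, ‖y - w‖ := by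
    have : Nonempty C := ⟨⟨p, hp.1⟩⟩
    refine le_antisymm (le_ciInf fun w => ?_) (ciInf_le ⟨0, ?_⟩ (⟨p, hp.1⟩ : C))
    · rw [norm_sub_rev y p, norm_sub_rev y w]
      exact hp.2 w w.2
    · rintro _ ⟨w, rfl⟩
      exact norm_nonneg _
  have hin := (norm_eq_iInf_iff_real_inner_le_zero hC hp.1).1 hinf z hz
  have hdec : y - z = (y - p) - (z - p) := by abel
  rw [norm_sub_rev p z, hdec, norm_sub_sq_real (y - p)]
  nlinarith [sq_nonneg ‖y - p‖]

/-- First-order upper bound on the decrease of a convex function. -/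
theorem ConvexOn.sub_le_inner_gradient {E : Type*} [NormedAddCommGroup E]
    [InnerProductSpace ℝ E] [CompleteSpace E] {f : E → ℝ} (hf : ConvexOn ℝ Set.univ f)
    {v x : E} (hv : HasGradientAt f v x) (y : E) :
    f x - f y ≤ inner ℝ v (x - y) := by
  have hconv : ConvexOn ℝ Set.univ (f ∘ AffineMap.lineMap (k := ℝ) x y) := by
    simpa using hf.comp_affineMap (AffineMap.lineMap (k := ℝ) x y)
  have hline : HasDerivAt (AffineMap.lineMap (k := ℝ) x y) (y - x) (0 : ℝ) :=
    AffineMap.hasDerivAt_lineMap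
  have hv' : HasFDerivAt f (InnerProductSpace.toDual ℝ E v) (AffineMap.lineMap x y (0 : ℝ)) := by
    simpa using hv.hasFDerivAt
  have hder := hv'.comp_hasDerivAt (0 : ℝ) hline
  have hslope := hconv.le_slope_of_hasDerivAt (Set.mem_univ 0) (Set.mem_univ 1) one_pos hder
  simp only [InnerProductSpace.toDual_apply_apply, slope_def_field, Function.comp_apply,
    AffineMap.lineMap_apply_zero, AffineMap.lineMap_apply_one, sub_zero, div_one] at hslope
  rw [inner_sub_right] at hslope ⊢
  linarith

/-- The squared norm of `v + ∑ i, c i • w i` when all the vectors have norm at most `G`. -/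
theorem norm_add_sum_smul_sq_le {E : Type*} [NormedAddCommGroup E] [NormedSpace ℝ E] {m : ℕ}
    {G : ℝ} (v : E) (w : Fin m → E) (c : Fin m → ℝ) (hv : ‖v‖ ≤ G) (hw : ∀ i, ‖w i‖ ≤ G) :
    ‖v + ∑ i, c i • w i‖ ^ 2 ≤ (m + 1) * G ^ 2 * (1 + ∑ i, c i ^ 2) := by
  have hnorm : ‖v + ∑ i, c i • w i‖ ≤ G * (1 + ∑ i, |c i|) := by
    calc ‖v + ∑ i, c i • w i‖ ≤ ‖v‖ + ∑ i, ‖c i • w i‖ :=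
          (norm_add_le _ _).trans (by gcongr; exact norm_sum_le _ _)
      _ ≤ G + ∑ i, |c i| * G := by
          gcongr with i
          rw [norm_smul, Real.norm_eq_abs]
          exact mul_le_mul_of_nonneg_left (hw i) (abs_nonneg _)
      _ = G * (1 + ∑ i, |c i|) := by rw [← Finset.sum_mul]; ring
  have hcs : (1 + ∑ i, |c i|) ^ 2 ≤ (m + 1) * (1 + ∑ i, c i ^ 2) := by
    have h := sq_sum_le_card_mul_sum_sq (s := (Finset.univ : Finset (Fin (m + 1))))
      (f := Fin.cons 1 fun i => |c i|)
    simpa [Fin.sum_univ_succ] using h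
  calc ‖v + ∑ i, c i • w i‖ ^ 2 ≤ (G * (1 + ∑ i, |c i|)) ^ 2 := by gcongr
    _ = G ^ 2 * (1 + ∑ i, |c i|) ^ 2 := by ring
    _ ≤ G ^ 2 * ((m + 1) * (1 + ∑ i, c i ^ 2)) := by gcongr
    _ = _ := by ring

/-- One step of projected gradient ascent on `l ↦ a l - (η δ / 2) l²` over `[0, ∞)`. -/
theorem dual_step_le {η δ D a l u : ℝ} (hη : 0 < η) (hδ : 0 < δ) (ha : |a| ≤ D) (hu : 0 ≤ u) :
    (max 0 (l + η * (a - η * δ * l)) - u) ^ 2 ≤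
      (l - u) ^ 2 + 2 * η * ((l - u) * a) + η ^ 2 * δ * u ^ 2 - η ^ 2 * δ * l ^ 2
        + η ^ 2 * (2 * D ^ 2 + 2 * δ ^ 2 * η ^ 2 * l ^ 2) := by
  have hproj : (max 0 (l + η * (a - η * δ * l)) - u) ^ 2
      ≤ (l + η * (a - η * δ * l) - u) ^ 2 := by
    rcases max_cases 0 (l + η * (a - η * δ * l)) with ⟨h, h'⟩ | ⟨h, h'⟩ <;> rw [h]
    nlinarith
  have ha2 : a ^ 2 ≤ D ^ 2 := sq_le_sq' (abs_le.1 ha).1 (abs_le.1 ha).2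
  have hsq : η ^ 2 * (a - η * δ * l) ^ 2 ≤ η ^ 2 * (2 * D ^ 2 + 2 * δ ^ 2 * η ^ 2 * l ^ 2) := by
    gcongr
    nlinarith [sq_nonneg (a + η * δ * l)]
  have hconc : 0 ≤ η ^ 2 * δ * (l - u) ^ 2 := by positivity
  nlinarith

/-- Under the additional condition `δ ≥ (m+1)G² + 2mδ²η²`, the iterates of
Algorithm 1 satisfy the combined regret / constraint-violation bound with respect to a
minimizer `x_*` of `∑_t f_t` over `K = {x : g_i(x) ≤ 0 ∀ i}`. -/
theorem stmt3 {d m T : ℕ} (R G D η δ : ℝ)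
    (hR : 0 < R) (hG : 0 < G) (hD : 0 < D) (hη : 0 < η) (hδ : 0 < δ)
    (g : Fin m → EuclideanSpace ℝ (Fin d) → ℝ)
    (f : ℕ → EuclideanSpace ℝ (Fin d) → ℝ)
    (hgconv : ∀ i, ConvexOn ℝ Set.univ (g i))
    (hfconv : ∀ t, ConvexOn ℝ Set.univ (f t))
    (gg : Fin m → EuclideanSpace ℝ (Fin d) → EuclideanSpace ℝ (Fin d))
    (gf : ℕ → EuclideanSpace ℝ (Fin d) → EuclideanSpace ℝ (Fin d))
    (hgg : ∀ i x, HasGradientAt (g i) (gg i x) x)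
    (hgf : ∀ t x, HasGradientAt (f t) (gf t x) x)
    (hggB : ∀ i, ∀ x ∈ Metric.closedBall (0 : EuclideanSpace ℝ (Fin d)) R, ‖gg i x‖ ≤ G)
    (hgfB : ∀ t, ∀ x ∈ Metric.closedBall (0 : EuclideanSpace ℝ (Fin d)) R, ‖gf t x‖ ≤ G)
    (hgB : ∀ i, ∀ x ∈ Metric.closedBall (0 : EuclideanSpace ℝ (Fin d)) R, |g i x| ≤ D)
    (hKne : {x : EuclideanSpace ℝ (Fin d) | ∀ i, g i x ≤ 0}.Nonempty)
    (hKB : {x : EuclideanSpace ℝ (Fin d) | ∀ i, g i x ≤ 0} ⊆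
      Metric.closedBall (0 : EuclideanSpace ℝ (Fin d)) R)
    (x : ℕ → EuclideanSpace ℝ (Fin d)) (lam : ℕ → EuclideanSpace ℝ (Fin m))
    (hx1 : x 1 = 0) (hlam1 : lam 1 = 0)
    (hxupd : ∀ t, 1 ≤ t →
      IsProjOn (Metric.closedBall (0 : EuclideanSpace ℝ (Fin d)) R)
        (x t - η • (gf t (x t) + ∑ i, lam t i • gg i (x t))) (x (t + 1)))
    (hlamupd : ∀ t, 1 ≤ t → ∀ i,
      lam (t + 1) i = max 0 (lam t i + η * (g i (x t) - η * δ * lam t i)))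
    (Fc : ℝ)
    (hF : ∀ t ∈ Finset.Icc 1 T, ∀ y ∈ {x : EuclideanSpace ℝ (Fin d) | ∀ i, g i x ≤ 0},
      ∀ y' ∈ {x : EuclideanSpace ℝ (Fin d) | ∀ i, g i x ≤ 0}, f t y - f t y' ≤ Fc)
    (hδcond : (m + 1) * G ^ 2 + 2 * m * δ ^ 2 * η ^ 2 ≤ δ)
    (xstar : EuclideanSpace ℝ (Fin d))
    (hxstar : xstar ∈ {x : EuclideanSpace ℝ (Fin d) | ∀ i, g i x ≤ 0})
    (hxstarmin : ∀ y ∈ {x : EuclideanSpace ℝ (Fin d) | ∀ i, g i x ≤ 0},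
      ∑ t ∈ Finset.Icc 1 T, f t xstar ≤ ∑ t ∈ Finset.Icc 1 T, f t y) :
    ∑ t ∈ Finset.Icc 1 T, (f t (x t) - f t xstar)
      + ∑ i, (max 0 (∑ t ∈ Finset.Icc 1 T, g i (x t))) ^ 2 / (2 * (δ * η * T + m / η))
    ≤ R ^ 2 / (2 * η) + η * T / 2 * ((m + 1) * G ^ 2 + 2 * m * D ^ 2) := by
  set B := Metric.closedBall (0 : EuclideanSpace ℝ (Fin d)) R with hB
  have hxsB : xstar ∈ B := hKB hxstar
  have hxB : ∀ t, 1 ≤ t → x t ∈ B := by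
    intro t ht
    obtain rfl | h := ht.eq_or_lt
    · simp [hx1, hB, hR.le]
    · obtain ⟨s, rfl⟩ : ∃ s, t = s + 1 := ⟨t - 1, by lia⟩
      exact (hxupd s (by lia)).1
  have hlam0 : ∀ t, 1 ≤ t → ∀ i, 0 ≤ lam t i := by
    intro t ht i
    obtain rfl | h := ht.eq_or_lt
    · simp [hlam1]
    · obtain ⟨s, rfl⟩ : ∃ s, t = s + 1 := ⟨t - 1, by lia⟩
      rw [hlamupd s (by lia) i]
      exact le_max_left _ _
  set c := δ * η * T + m / η with hc
  set S : Fin m → ℝ := fun i => ∑ t ∈ Finset.Icc 1 T, g i (x t) with hS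
  have hc0 : 0 ≤ c := by positivity
  set u : Fin m → ℝ := fun i => max 0 (S i) / c with hu
  have hu0 : ∀ i, 0 ≤ u i := fun i => div_nonneg (le_max_left _ _) hc0
  set C := (m + 1) * G ^ 2 + 2 * m * D ^ 2 with hC
  set P : ℕ → ℝ := fun t => ‖x t - xstar‖ ^ 2 + ∑ i, (lam t i - u i) ^ 2 with hP
  have hstep : ∀ t, 1 ≤ t →
      2 * η * (f t (x t) - f t xstar + ∑ i, u i * g i (x t)) - η ^ 2 * δ * ∑ i, u i ^ 2
        ≤ P t - P (t + 1) + η ^ 2 * C := by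
    intro t ht
    set v := gf t (x t) + ∑ i, lam t i • gg i (x t) with hv
    set Λ := ∑ i, lam t i ^ 2 with hΛ
    have hprimal : ‖x (t + 1) - xstar‖ ^ 2
        ≤ ‖x t - xstar‖ ^ 2 - 2 * η * inner ℝ v (x t - xstar) + η ^ 2 * ‖v‖ ^ 2 := by
      refine ((hxupd t ht).norm_sub_sq_le (convex_closedBall _ _) hxsB).trans_eq ?_
      rw [sub_right_comm, norm_sub_sq_real, norm_smul, Real.norm_of_nonneg hη.le,
        inner_smul_right, real_inner_comm]
      ring
    have hvnorm : ‖v‖ ^ 2 ≤ (m + 1) * G ^ 2 * (1 + Λ) :=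
      norm_add_sum_smul_sq_le _ _ _ (hgfB t _ (hxB t ht)) fun i => hggB i _ (hxB t ht)
    have hinner : f t (x t) - f t xstar + ∑ i, lam t i * g i (x t)
        ≤ inner ℝ v (x t - xstar) := by
      rw [hv, inner_add_left, sum_inner]
      refine add_le_add ((hfconv t).sub_le_inner_gradient (hgf t _) _)
        (Finset.sum_le_sum fun i _ => ?_)
      rw [real_inner_smul_left]
      refine mul_le_mul_of_nonneg_left ?_ (hlam0 t ht i)
      linarith [(hgconv i).sub_le_inner_gradient (hgg i (x t)) xstar, hxstar i]
    have hdual : ∑ i, (lam (t + 1) i - u i) ^ 2 ≤ ∑ i, (lam t i - u i) ^ 2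
        + 2 * η * (∑ i, lam t i * g i (x t) - ∑ i, u i * g i (x t))
        + η ^ 2 * δ * ∑ i, u i ^ 2 - η ^ 2 * δ * Λ
        + η ^ 2 * (2 * m * D ^ 2 + 2 * δ ^ 2 * η ^ 2 * Λ) := by
      refine (Finset.sum_le_sum fun i _ => (hlamupd t ht i).symm ▸
        dual_step_le hη hδ (hgB i _ (hxB t ht)) (hu0 i)).trans_eq ?_
      simp only [Finset.sum_add_distrib, Finset.sum_sub_distrib, ← Finset.mul_sum, sub_mul,
        Finset.sum_const, Finset.card_univ, Fintype.card_fin, nsmul_eq_mul, ← hΛ]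
      ring
    have habsorb : ((m + 1) * G ^ 2 + 2 * δ ^ 2 * η ^ 2) * Λ ≤ δ * Λ := by
      rcases Nat.eq_zero_or_pos m with rfl | hm
      · simp [hΛ]
      · have hm1 : (1 : ℝ) ≤ m := by exact_mod_cast hm
        refine mul_le_mul_of_nonneg_right (le_trans ?_ hδcond)
          (Finset.sum_nonneg fun i _ => sq_nonneg _)
        nlinarith [mul_nonneg (sub_nonneg.2 hm1) (sq_nonneg (δ * η))]
    have h1 := mul_le_mul_of_nonneg_left hvnorm (sq_nonneg η)
    have h2 := mul_le_mul_of_nonneg_left hinner hη.le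
    have h3 := mul_le_mul_of_nonneg_left habsorb (sq_nonneg η)
    simp only [hP, hC]
    linarith
  have htel : ∀ n : ℕ, ∑ t ∈ Finset.Icc 1 n, (P t - P (t + 1)) = P 1 - P (n + 1) := by
    intro n
    induction n with
    | zero => simp
    | succ k ih => rw [Finset.sum_Icc_succ_top (by lia), ih]; ring
  have hsum := Finset.sum_le_sum fun t (ht : t ∈ Finset.Icc 1 T) =>
    hstep t (Finset.mem_Icc.1 ht).1
  have hSu : ∑ t ∈ Finset.Icc 1 T, ∑ i, u i * g i (x t) = ∑ i, u i * S i := by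
    rw [Finset.sum_comm]
    simp only [hS, Finset.mul_sum]
  rw [Finset.sum_sub_distrib, Finset.sum_add_distrib, htel, ← Finset.mul_sum,
    Finset.sum_add_distrib, hSu] at hsum
  simp only [Finset.sum_const, Nat.card_Icc, add_tsub_cancel_right, nsmul_eq_mul] at hsum
  have hP1 : P 1 ≤ R ^ 2 + ∑ i, u i ^ 2 := by
    have h : ‖xstar‖ ≤ R := by simpa [hB] using hxsB
    simp only [hP, hx1, hlam1, zero_sub, norm_neg, PiLp.zero_apply, neg_sq]
    gcongr
  have hPT : 0 ≤ P (T + 1) :=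
    add_nonneg (sq_nonneg _) (Finset.sum_nonneg fun i _ => sq_nonneg _)
  have hviol : 2 * η * ∑ i, max 0 (S i) ^ 2 / (2 * c)
      ≤ 2 * η * ∑ i, u i * S i - (η ^ 2 * δ * T + 1) * ∑ i, u i ^ 2 := by
    rw [Finset.mul_sum, Finset.mul_sum, Finset.mul_sum, ← Finset.sum_sub_distrib]
    refine Finset.sum_le_sum fun i _ => ?_
    have hm1 : (1 : ℝ) ≤ m := by exact_mod_cast i.pos
    have hcpos : 0 < c := by positivity
    have hηc : η ^ 2 * δ * T + 1 ≤ η * c := by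
      have : η * c = η ^ 2 * δ * T + m := by rw [hc]; field_simp
      linarith
    have hmax : max 0 (S i) = c * u i := by simp only [hu]; field_simp
    have huS : u i * S i = c * u i ^ 2 := by
      have : max 0 (S i) * S i = max 0 (S i) ^ 2 := by
        rcases max_cases 0 (S i) with ⟨h, -⟩ | ⟨h, -⟩ <;> rw [h] <;> ring
      rw [hmax] at this
      exact mul_left_cancel₀ hcpos.ne' (by linarith)
    have hquot : max 0 (S i) ^ 2 / (2 * c) = c * u i ^ 2 / 2 := by
      rw [hmax]; field_simp
    rw [hquot, huS]
    nlinarith [mul_le_mul_of_nonneg_right hηc (sq_nonneg (u i))]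
  have hrhs : 2 * η * (R ^ 2 / (2 * η) + η * T / 2 * C) = R ^ 2 + T * (η ^ 2 * C) := by
    field_simp
  refine le_of_mul_le_mul_left ?_ (by positivity : 0 < 2 * η)
  rw [hrhs]
  linarith
end

section
/- If η(m + δ²η²) ≤ 1/4, then for every t ∈ [T] and every (x, λ) ∈ B × [0,∞)^m, the iterates of Algorithm 2 satisfy: L_t(x_t, λ) − L_t(x, λ_t) ≤ (‖x − z_t‖² − ‖x − z_{t+1}‖²)/(2η) + (‖λ − μ_t‖² − ‖λ − μ_{t+1}‖²)/(2η) + η‖∇f_t(x_t)‖². -/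
open RealInnerProductSpace Finset

section Auxiliary

variable {E : Type*} [NormedAddCommGroup E] [InnerProductSpace ℝ E]

/-- The first-order (gradient) inequality for a differentiable convex function. -/
lemma ConvexOn.sub_le_inner_of_hasGradientAt [CompleteSpace E] {f : E → ℝ} {g x : E}
    (hf : ConvexOn ℝ Set.univ f) (hg : HasGradientAt f g x) (y : E) :
    f x - f y ≤ ⟪g, x - y⟫ := by
  have hline : HasDerivAt (fun s : ℝ => AffineMap.lineMap x y s) (y - x) 0 :=
    AffineMap.hasDerivAt_lineMap
  have hconv : ConvexOn ℝ Set.univ (f ∘ (AffineMap.lineMap x y : ℝ →ᵃ[ℝ] E)) := by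
    simpa using hf.comp_affineMap (AffineMap.lineMap x y : ℝ →ᵃ[ℝ] E)
  have hfd : HasFDerivAt f (InnerProductSpace.toDual ℝ E g) (AffineMap.lineMap x y (0 : ℝ)) := by
    simpa using hg.hasFDerivAt
  have hslope := hconv.le_slope_of_hasDerivAt (Set.mem_univ 0) (Set.mem_univ 1) one_pos
    (hfd.comp_hasDerivAt (0 : ℝ) hline)
  simp only [slope_def_field, Function.comp_apply, AffineMap.lineMap_apply_one,
    AffineMap.lineMap_apply_zero, InnerProductSpace.toDual_apply_apply, sub_zero, div_one] at hslope
  rw [← neg_sub y x, inner_neg_right]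
  linarith

/-- The variational inequality characterizing the projection onto a convex set. -/
lemma IsProjOn.inner_sub_le_zero {C : Set E} (hC : Convex ℝ C) {y p w : E}
    (h : IsProjOn C y p) (hw : w ∈ C) : ⟪y - p, w - p⟫ ≤ 0 := by
  refine (norm_eq_iInf_iff_real_inner_le_zero hC h.1).1 ?_ w hw
  have : Nonempty C := ⟨⟨p, h.1⟩⟩
  refine le_antisymm (le_ciInf fun v => ?_) ?_
  · rw [norm_sub_rev y p, norm_sub_rev y v]
    exact h.2 v v.2
  · exact ciInf_le (f := fun v : C => ‖y - v‖)
      ⟨0, by rintro _ ⟨v, rfl⟩; exact norm_nonneg _⟩ ⟨p, h.1⟩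

/-- The one-step inequality of the mirror-prox method with Euclidean projections. -/
lemma IsProjOn.inner_extragradient_le {C : Set E} (hC : Convex ℝ C) {η : ℝ} {u v z x z' p : E}
    (hx : IsProjOn C (z - η • v) x) (hz' : IsProjOn C (z - η • u) z') (hp : p ∈ C) :
    η * ⟪u, x - p⟫ ≤ (‖p - z‖ ^ 2 - ‖p - z'‖ ^ 2) / 2 + η ^ 2 * ‖u - v‖ ^ 2 / 2
      - ‖x - z‖ ^ 2 / 2 := by
  have h1 := hx.inner_sub_le_zero hC hz'.1
  have h2 := hz'.inner_sub_le_zero hC hp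
  have h3 : 0 ≤ ‖η • (u - v) - (x - z')‖ ^ 2 := sq_nonneg _
  simp only [← real_inner_self_eq_norm_sq, inner_sub_left, inner_sub_right, inner_smul_left,
    inner_smul_right, RCLike.conj_to_real] at *
  simp only [real_inner_comm u v, real_inner_comm u x, real_inner_comm u z', real_inner_comm v x,
    real_inner_comm v z', real_inner_comm x z', real_inner_comm z x,
    real_inner_comm z p, real_inner_comm z' p] at *
  nlinarith

lemma isProjOn_Ici_max (y : ℝ) : IsProjOn (Set.Ici 0) y (max 0 y) := by
  refine ⟨Set.mem_Ici.2 (le_max_left _ _), fun z hz => ?_⟩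
  rw [Set.mem_Ici] at hz
  rcases le_total 0 y with h | h
  · simp [max_eq_right h]
  · rw [max_eq_left h, Real.norm_eq_abs, Real.norm_eq_abs, abs_of_nonneg (by linarith),
      abs_of_nonneg (by linarith)]
    linarith

/-- The dual step of the mirror-prox method for a single linear constraint. -/
lemma dual_step_le_s10 {η c b l μ μ' l' : ℝ} (hη : 0 < η) (hc : 0 ≤ c) {a x y z : E} (ha : ‖a‖ = 1)
    (hl : l = max 0 (μ + η * ((⟪a, z⟫ - b) - c * μ)))
    (hμ' : μ' = max 0 (μ + η * ((⟪a, x⟫ - b) - c * l))) (hl' : 0 ≤ l') :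
    η * ((l' * (⟪a, x⟫ - b) - c / 2 * l' ^ 2) - (l * (⟪a, y⟫ - b) - c / 2 * l ^ 2))
      ≤ η * (l * ⟪a, x - y⟫) + ((l' - μ) ^ 2 - (l' - μ') ^ 2) / 2
        + η ^ 2 * (‖x - z‖ ^ 2 + c ^ 2 * (l - μ) ^ 2) - (l - μ) ^ 2 / 2 := by
  have h1 : IsProjOn (Set.Ici 0) (μ - η • (-((⟪a, z⟫ - b) - c * μ))) l := by
    rw [hl, smul_eq_mul, mul_neg, sub_neg_eq_add]
    exact isProjOn_Ici_max _
  have h2 : IsProjOn (Set.Ici 0) (μ - η • (-((⟪a, x⟫ - b) - c * l))) μ' := by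
    rw [hμ', smul_eq_mul, mul_neg, sub_neg_eq_add]
    exact isProjOn_Ici_max _
  have h3 := h1.inner_extragradient_le (convex_Ici 0) h2 (Set.mem_Ici.2 hl')
  have hdiff : -((⟪a, x⟫ - b) - c * l) - -((⟪a, z⟫ - b) - c * μ)
      = -(⟪a, x - z⟫ - c * (l - μ)) := by
    rw [inner_sub_right]; ring
  rw [hdiff] at h3
  simp only [Real.norm_eq_abs, sq_abs, RCLike.inner_apply, RCLike.conj_to_real, neg_sq] at h3
  have hcs : ⟪a, x - z⟫ ^ 2 ≤ ‖x - z‖ ^ 2 := by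
    have := abs_real_inner_le_norm a (x - z)
    rw [ha, one_mul] at this
    exact sq_le_sq.2 (by rwa [abs_norm])
  have hsq : (⟪a, x - z⟫ - c * (l - μ)) ^ 2 ≤ 2 * (‖x - z‖ ^ 2 + c ^ 2 * (l - μ) ^ 2) := by
    nlinarith [sq_nonneg (⟪a, x - z⟫ + c * (l - μ))]
  have hsq' := mul_le_mul_of_nonneg_left hsq (sq_nonneg η)
  have hconc : 0 ≤ η * (c * (l' - l) ^ 2) := by positivity
  rw [inner_sub_right a x y]
  linarith

/-- The squared norm of a combination of `m` unit vectors is at most `m` times the sum of the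
squared coefficients. -/
lemma norm_sum_smul_sq_le {m : ℕ} (a : Fin m → E) (ha : ∀ i, ‖a i‖ = 1) (r : Fin m → ℝ) :
    ‖∑ i, r i • a i‖ ^ 2 ≤ m * ∑ i, r i ^ 2 := by
  calc ‖∑ i, r i • a i‖ ^ 2 ≤ (∑ i, |r i|) ^ 2 := by
        gcongr
        refine (norm_sum_le _ _).trans_eq (sum_congr rfl fun i _ => ?_)
        rw [norm_smul, ha, mul_one, Real.norm_eq_abs]
    _ ≤ m * ∑ i, r i ^ 2 := by
        simpa using sq_sum_le_card_mul_sum_sq (s := univ) (f := fun i => |r i|)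

/-- The step-size condition bounds the squared Lipschitz constant of the saddle operator. -/
lemma sq_mul_le_half_of_step_size {m : ℕ} {η q : ℝ} (hm : m ≠ 0) (hη : 0 < η) (hq : 0 ≤ q)
    (h : η * (m + q) ≤ 1 / 4) : η ^ 2 * (m + q) ≤ 1 / 2 := by
  have hm' : (1 : ℝ) ≤ m := by exact_mod_cast Nat.one_le_iff_ne_zero.2 hm
  have hη' : η ≤ 1 / 4 := by nlinarith
  nlinarith

end Auxiliary

/-- Lemma 3 of the paper. If `η(m + δ²η²) ≤ 1/4`, the iterates of the
mirror-prox Algorithm 2 (with linear constraints `g_i(x) = ⟨a_i,x⟩ − b_i`, `‖a_i‖ = 1`)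
satisfy, for every `t ∈ [T]`, `x ∈ B`, `λ ∈ [0,∞)^m`:
`L_t(x_t,λ) − L_t(x,λ_t) ≤ (‖x−z_t‖² − ‖x−z_{t+1}‖²)/(2η) + (‖λ−μ_t‖² − ‖λ−μ_{t+1}‖²)/(2η)
  + η‖∇f_t(x_t)‖²`. -/
theorem stmt10 {d m T : ℕ} (R G η δ : ℝ)
    (hR : 0 < R) (hG : 0 < G) (hη : 0 < η) (hδ : 0 < δ)
    (a : Fin m → EuclideanSpace ℝ (Fin d)) (bb : Fin m → ℝ) (ha : ∀ i, ‖a i‖ = 1)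
    (hKne : {x : EuclideanSpace ℝ (Fin d) | ∀ i, ⟪a i, x⟫ - bb i ≤ 0}.Nonempty)
    (hKB : {x : EuclideanSpace ℝ (Fin d) | ∀ i, ⟪a i, x⟫ - bb i ≤ 0} ⊆
      Metric.closedBall (0 : EuclideanSpace ℝ (Fin d)) R)
    (f : ℕ → EuclideanSpace ℝ (Fin d) → ℝ)
    (hfconv : ∀ t, ConvexOn ℝ Set.univ (f t))
    (gf : ℕ → EuclideanSpace ℝ (Fin d) → EuclideanSpace ℝ (Fin d))
    (hgf : ∀ t x, HasGradientAt (f t) (gf t x) x)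
    (hgfB : ∀ t, ∀ x ∈ Metric.closedBall (0 : EuclideanSpace ℝ (Fin d)) R, ‖gf t x‖ ≤ G)
    -- Algorithm 2 iterates
    (z : ℕ → EuclideanSpace ℝ (Fin d)) (μ : ℕ → EuclideanSpace ℝ (Fin m))
    (x : ℕ → EuclideanSpace ℝ (Fin d)) (lam : ℕ → EuclideanSpace ℝ (Fin m))
    (hz1 : z 1 = 0) (hμ1 : μ 1 = 0)
    (hxdef : ∀ t, 1 ≤ t →
      IsProjOn (Metric.closedBall (0 : EuclideanSpace ℝ (Fin d)) R)
        (z t - η • ∑ i, μ t i • a i) (x t))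
    (hlamdef : ∀ t, 1 ≤ t → ∀ i,
      lam t i = max 0 (μ t i + η * ((⟪a i, z t⟫ - bb i) - δ * η * μ t i)))
    (hzupd : ∀ t, 1 ≤ t →
      IsProjOn (Metric.closedBall (0 : EuclideanSpace ℝ (Fin d)) R)
        (z t - η • (gf t (x t) + ∑ i, lam t i • a i)) (z (t + 1)))
    (hμupd : ∀ t, 1 ≤ t → ∀ i,
      μ (t + 1) i = max 0 (μ t i + η * ((⟪a i, x t⟫ - bb i) - δ * η * lam t i)))
    -- the step-size condition
    (hcond : η * (m + δ ^ 2 * η ^ 2) ≤ 1 / 4) :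
    ∀ t ∈ Finset.Icc 1 T, ∀ xx ∈ Metric.closedBall (0 : EuclideanSpace ℝ (Fin d)) R,
      ∀ lam' : EuclideanSpace ℝ (Fin m), (∀ i, 0 ≤ lam' i) →
      (f t (x t) + ∑ i, (lam' i * (⟪a i, x t⟫ - bb i) - δ * η / 2 * lam' i ^ 2))
        - (f t xx + ∑ i, (lam t i * (⟪a i, xx⟫ - bb i) - δ * η / 2 * lam t i ^ 2))
      ≤ (‖xx - z t‖ ^ 2 - ‖xx - z (t + 1)‖ ^ 2) / (2 * η)
        + (‖lam' - μ t‖ ^ 2 - ‖lam' - μ (t + 1)‖ ^ 2) / (2 * η)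
        + η * ‖gf t (x t)‖ ^ 2 := by
  intro t ht xx hxx lam' hlam'
  have ht1 : 1 ≤ t := (Finset.mem_Icc.1 ht).1
  have hconv := (hfconv t).sub_le_inner_of_hasGradientAt (hgf t (x t)) xx
  have hprimal := (hxdef t ht1).inner_extragradient_le (convex_closedBall _ _) (hzupd t ht1) hxx
  have hdual := Finset.sum_le_sum fun i (_ : i ∈ Finset.univ) =>
    dual_step_le_s10 (y := xx) hη (mul_pos hδ hη).le (ha i) (hlamdef t ht1 i) (hμupd t ht1 i) (hlam' i)
  simp only [Finset.sum_add_distrib, Finset.sum_sub_distrib, ← Finset.mul_sum, ← Finset.sum_div,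
    Finset.sum_const, Finset.card_univ, Fintype.card_fin, nsmul_eq_mul] at hdual
  set S := ∑ i, (lam t i - μ t i) ^ 2 with hS
  set g := gf t (x t)
  have hgrad : ‖g + ∑ i, lam t i • a i - ∑ i, μ t i • a i‖ ^ 2 ≤ 2 * (‖g‖ ^ 2 + m * S) := by
    have hcomb := norm_sum_smul_sq_le a ha fun i => lam t i - μ t i
    have hadd := parallelogram_law_with_norm ℝ g (∑ i, (lam t i - μ t i) • a i)
    have heq : g + ∑ i, lam t i • a i - ∑ i, μ t i • a i
        = g + ∑ i, (lam t i - μ t i) • a i := by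
      simp only [sub_smul, Finset.sum_sub_distrib]
      abel
    rw [heq]
    nlinarith [sq_nonneg ‖g - ∑ i, (lam t i - μ t i) • a i‖]
  have hgrad' := mul_le_mul_of_nonneg_left hgrad (sq_nonneg η)
  have hinner : ⟪∑ i, lam t i • a i, x t - xx⟫ = ∑ i, lam t i * ⟪a i, x t - xx⟫ := by
    simp only [sum_inner, real_inner_smul_left]
  rw [inner_add_left, hinner] at hprimal
  have hstep : η ^ 2 * (m * ‖x t - z t‖ ^ 2) ≤ ‖x t - z t‖ ^ 2 / 2 ∧
      η ^ 2 * (m * S + (δ * η) ^ 2 * S) ≤ S / 2 := by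
    rcases Nat.eq_zero_or_pos m with rfl | hm
    · constructor
      · simp; positivity
      · simp [hS]
    · have hs := sq_mul_le_half_of_step_size hm.ne' hη (by positivity) hcond
      have hS0 : 0 ≤ S := Finset.sum_nonneg fun i _ => sq_nonneg _
      have hm2 : η ^ 2 * m ≤ 1 / 2 := by
        have : 0 ≤ η ^ 2 * (δ ^ 2 * η ^ 2) := by positivity
        linarith
      constructor
      · linarith [mul_le_mul_of_nonneg_right hm2 (sq_nonneg ‖x t - z t‖)]
      · linarith [mul_le_mul_of_nonneg_right hs hS0]
  have hnorm1 : ‖lam' - μ t‖ ^ 2 = ∑ i, (lam' i - μ t i) ^ 2 := by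
    simp [EuclideanSpace.real_norm_sq_eq]
  have hnorm2 : ‖lam' - μ (t + 1)‖ ^ 2 = ∑ i, (lam' i - μ (t + 1) i) ^ 2 := by
    simp [EuclideanSpace.real_norm_sq_eq]
  have hconv' := mul_le_mul_of_nonneg_left hconv hη.le
  rw [hnorm1, hnorm2]
  simp only [Finset.sum_sub_distrib, ← Finset.mul_sum]
  refine le_of_mul_le_mul_left ?_ hη
  have hrhs : ∀ A B : ℝ, η * (A / (2 * η) + B / (2 * η) + η * ‖g‖ ^ 2)
      = A / 2 + B / 2 + η ^ 2 * ‖g‖ ^ 2 := by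
    intro A B
    field_simp
  rw [hrhs]
  linarith [hstep.1, hstep.2]
end
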